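/- Let d ≥ 1 and α ∈ [0,1]. There exists a constant C > 0, depending only on α and d, such that for every Schwartz function u : ℝ^d → ℂ and all indices i, j ∈ {1,…,d}, | Re ∫_{ℝ^d} (1 + ‖x‖²)^{α−1}·2α·x_j · conj(∂_{x_j} u(x)) · ∂²_{x_i} u(x) dx | ≤ C·( ‖∂_{x_i} u‖_{L²}² + ‖u‖_{L²}² + ‖∂_{x_j} u‖_{L²}² ). -/

import Mathlib

open MeasureTheory

open scoped SchwartzMap LineDeriv

namespace SchwartzMap

section WeightedIntegration

variable {D V : Type*} [NormedAddCommGroup D] [NormedSpace ℝ D]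
  [NormedAddCommGroup V] [InnerProductSpace ℝ V]

theorem lineDerivOp_lineDerivOp_comm (u : 𝓢(D, V)) (v w : D) :
    ∂_{v} (∂_{w} u : 𝓢(D, V)) = ∂_{w} (∂_{v} u : 𝓢(D, V)) := by
  have second (a b : D) (x : D) :
      (∂_{a} (∂_{b} u : 𝓢(D, V)) : 𝓢(D, V)) x = fderiv ℝ (fderiv ℝ u) x a b := by
    have hdiff : DifferentiableAt ℝ (fderiv ℝ u) x := (fderivCLM ℝ D V u).differentiableAt
    have heq : ⇑(∂_{b} u : 𝓢(D, V)) = fun y => fderiv ℝ u y b := rfl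
    rw [lineDerivOp_apply_eq_fderiv, heq, fderiv_clm_apply hdiff (differentiableAt_const b)]
    simp
  ext x
  rw [second, second]
  exact ((u.smooth 2).contDiffAt.isSymmSndFDerivAt (by simp)).eq v w

variable {b : D → ℝ}

theorem lineDerivOp_smulLeftCLM_apply (hb : b.HasTemperateGrowth) (f : 𝓢(D, V)) (v x : D) :
    (∂_{v} (smulLeftCLM V b f) : 𝓢(D, V)) x = b x • ∂_{v} f x + fderiv ℝ b x v • f x := by
  have hdiff : DifferentiableAt ℝ b x := hb.1.differentiable (by simp) x
  rw [lineDerivOp_apply_eq_fderiv, smulLeftCLM_apply hb, fderiv_fun_smul hdiff f.differentiableAt]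
  simp [lineDerivOp_apply_eq_fderiv]

variable [MeasurableSpace D] [BorelSpace D] [FiniteDimensional ℝ D]
  {μ : Measure D} [μ.IsAddHaarMeasure]

theorem integrable_inner (f g : 𝓢(D, V)) : Integrable (fun x => inner ℝ (f x) (g x)) μ :=
  (pairing (innerSL ℝ) f g).integrable

theorem integrable_mul_inner (hb : b.HasTemperateGrowth) (f g : 𝓢(D, V)) :
    Integrable (fun x => b x * inner ℝ (f x) (g x)) μ := by
  simpa [smulLeftCLM_apply_apply hb, real_inner_smul_left] using
    integrable_inner (μ := μ) (smulLeftCLM V b f) g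

theorem integrable_fderiv_mul_inner (hb : b.HasTemperateGrowth) (f g : 𝓢(D, V)) (v : D) :
    Integrable (fun x => fderiv ℝ b x v * inner ℝ (f x) (g x)) μ := by
  refine ((integrable_inner (μ := μ) (∂_{v} (smulLeftCLM V b f)) g).sub
    (integrable_mul_inner hb (∂_{v} f) g)).congr (.of_forall fun x => ?_)
  simp [lineDerivOp_smulLeftCLM_apply hb, inner_add_left, real_inner_smul_left]

/-- Integration by parts for the inner product of Schwartz functions with a weight. -/
theorem integral_mul_inner_lineDerivOp (hb : b.HasTemperateGrowth) (f g : 𝓢(D, V)) (v : D) :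
    ∫ x, b x * inner ℝ (f x) (∂_{v} g x) ∂μ =
      -(∫ x, b x * inner ℝ (∂_{v} f x) (g x) ∂μ)
        - ∫ x, fderiv ℝ b x v * inner ℝ (f x) (g x) ∂μ := by
  have h : ∫ x, inner ℝ (smulLeftCLM V b f x) (∂_{v} g x) ∂μ =
      -∫ x, inner ℝ ((∂_{v} (smulLeftCLM V b f) : 𝓢(D, V)) x) (g x) ∂μ :=
    integral_bilinear_lineDerivOp_right_eq_neg_left (smulLeftCLM V b f) g (innerSL ℝ) v
  simp only [lineDerivOp_smulLeftCLM_apply hb, smulLeftCLM_apply_apply hb,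
    inner_add_left, real_inner_smul_left] at h
  rw [h, integral_add (integrable_mul_inner hb _ _) (integrable_fderiv_mul_inner hb _ _ _)]
  ring

theorem integrable_norm_sq (f : 𝓢(D, V)) : Integrable (fun x => ‖f x‖ ^ 2) μ := by
  simpa using integrable_inner (μ := μ) f f

theorem abs_integral_mul_inner_le {c : D → ℝ} {K : ℝ} (hc : ∀ x, |c x| ≤ K) (f g : 𝓢(D, V)) :
    |∫ x, c x * inner ℝ (f x) (g x) ∂μ| ≤
      K / 2 * ((∫ x, ‖f x‖ ^ 2 ∂μ) + ∫ x, ‖g x‖ ^ 2 ∂μ) := by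
  rw [← integral_add (integrable_norm_sq f) (integrable_norm_sq g), ← integral_const_mul]
  refine norm_integral_le_of_norm_le (f := fun x => c x * inner ℝ (f x) (g x))
    (((integrable_norm_sq f).add (integrable_norm_sq g)).const_mul _) (.of_forall fun x => ?_)
  have hK : 0 ≤ K := (abs_nonneg _).trans (hc x)
  have hfg : |inner ℝ (f x) (g x)| ≤ (‖f x‖ ^ 2 + ‖g x‖ ^ 2) / 2 :=
    (abs_real_inner_le_norm _ _).trans (by linarith [two_mul_le_add_sq ‖f x‖ ‖g x‖])
  calc ‖c x * inner ℝ (f x) (g x)‖ = |c x| * |inner ℝ (f x) (g x)| := by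
        rw [Real.norm_eq_abs, abs_mul]
    _ ≤ K * ((‖f x‖ ^ 2 + ‖g x‖ ^ 2) / 2) := mul_le_mul (hc x) hfg (abs_nonneg _) hK
    _ = K / 2 * (‖f x‖ ^ 2 + ‖g x‖ ^ 2) := by ring

/-- A second derivative paired with a first derivative is controlled by first derivatives when the
weight has bounded derivatives in the two directions. -/
theorem abs_integral_mul_inner_lineDerivOp_le (hb : b.HasTemperateGrowth) {K : ℝ} {v w : D}
    (hv : ∀ x, |fderiv ℝ b x v| ≤ K) (hw : ∀ x, |fderiv ℝ b x w| ≤ K) (u : 𝓢(D, V)) :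
    |∫ x, b x * inner ℝ (∂_{w} u x) ((∂_{v} (∂_{v} u : 𝓢(D, V)) : 𝓢(D, V)) x) ∂μ| ≤
      K * ((∫ x, ‖∂_{v} u x‖ ^ 2 ∂μ) + ∫ x, ‖∂_{w} u x‖ ^ 2 ∂μ) := by
  have hK : 0 ≤ K := (abs_nonneg _).trans (hv 0)
  have h1 := integral_mul_inner_lineDerivOp (μ := μ) hb (∂_{w} u) (∂_{v} u) v
  have h2 := integral_mul_inner_lineDerivOp (μ := μ) hb (∂_{v} u) (∂_{v} u) w
  rw [lineDerivOp_lineDerivOp_comm u v w] at h1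
  simp_rw [fun x => real_inner_comm ((∂_{w} (∂_{v} u : 𝓢(D, V)) : 𝓢(D, V)) x) (∂_{v} u x)] at h1 h2
  have h3 := abs_le.1 (abs_integral_mul_inner_le (μ := μ) hv (∂_{w} u) (∂_{v} u))
  have h4 := abs_le.1 (abs_integral_mul_inner_le (μ := μ) hw (∂_{v} u) (∂_{v} u))
  have hnonneg : 0 ≤ K * ∫ x, ‖∂_{w} u x‖ ^ 2 ∂μ :=
    mul_nonneg hK (integral_nonneg fun x => sq_nonneg _)
  rw [abs_le]
  constructor <;> linarith

end WeightedIntegration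

end SchwartzMap

section Weight

variable {d : ℕ}

theorem hasTemperateGrowth_weight (α : ℝ) (j : Fin d) :
    (fun x : EuclideanSpace ℝ (Fin d) =>
      (1 + ‖x‖ ^ 2) ^ (α - 1) * (2 * α) * x j).HasTemperateGrowth := by
  have hj : (fun x : EuclideanSpace ℝ (Fin d) => x j).HasTemperateGrowth :=
    (EuclideanSpace.proj j : EuclideanSpace ℝ (Fin d) →L[ℝ] ℝ).hasTemperateGrowth
  exact ((Function.hasTemperateGrowth_one_add_norm_sq_rpow _ (α - 1)).mul
    (Function.HasTemperateGrowth.const (2 * α))).mul hj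

theorem fderiv_weight_single (α : ℝ) (i j : Fin d) (x : EuclideanSpace ℝ (Fin d)) :
    fderiv ℝ (fun x : EuclideanSpace ℝ (Fin d) => (1 + ‖x‖ ^ 2) ^ (α - 1) * (2 * α) * x j) x
        (EuclideanSpace.single i 1) =
      (1 + ‖x‖ ^ 2) ^ (α - 1) * (2 * α) * (EuclideanSpace.single i (1 : ℝ) j) +
        4 * (α * (α - 1)) * ((1 + ‖x‖ ^ 2) ^ (α - 1 - 1) * (x i * x j)) := by
  have hp : HasFDerivAt (fun x : EuclideanSpace ℝ (Fin d) => 1 + ‖x‖ ^ 2) (2 • innerSL ℝ x) x :=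
    (hasStrictFDerivAt_norm_sq x).hasFDerivAt.const_add 1
  have hj : HasFDerivAt (fun x : EuclideanSpace ℝ (Fin d) => x j)
      (EuclideanSpace.proj j : EuclideanSpace ℝ (Fin d) →L[ℝ] ℝ) x :=
    (EuclideanSpace.proj j : EuclideanSpace ℝ (Fin d) →L[ℝ] ℝ).hasFDerivAt
  have h := ((hp.rpow_const (p := α - 1) (Or.inl (by positivity))).mul_const (2 * α)).mul hj
  refine (DFunLike.congr_fun h.fderiv _).trans ?_
  simp [EuclideanSpace.inner_single_right]
  ring

theorem abs_fderiv_weight_single_le {α : ℝ} (hα : α ∈ Set.Icc (0 : ℝ) 1) (i j : Fin d)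
    (x : EuclideanSpace ℝ (Fin d)) :
    |fderiv ℝ (fun x : EuclideanSpace ℝ (Fin d) => (1 + ‖x‖ ^ 2) ^ (α - 1) * (2 * α) * x j) x
        (EuclideanSpace.single i 1)| ≤ 6 := by
  obtain ⟨h0, h1⟩ := hα
  have hp1 : (1 : ℝ) ≤ 1 + ‖x‖ ^ 2 := by nlinarith [sq_nonneg ‖x‖]
  have hp0 : (0 : ℝ) < 1 + ‖x‖ ^ 2 := by positivity
  have hrpow : (1 + ‖x‖ ^ 2) ^ (α - 1) ≤ 1 :=
    Real.rpow_le_one_of_one_le_of_nonpos hp1 (by linarith)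
  have hsingle : |EuclideanSpace.single i (1 : ℝ) j| ≤ 1 := by
    simpa using PiLp.norm_apply_le (EuclideanSpace.single i (1 : ℝ)) j
  have hxx : |x i * x j| ≤ 1 + ‖x‖ ^ 2 := by
    have hi := PiLp.norm_apply_le x i
    have hj := PiLp.norm_apply_le x j
    rw [Real.norm_eq_abs] at hi hj
    rw [abs_mul]
    nlinarith [mul_le_mul hi hj (abs_nonneg _) (norm_nonneg x)]
  have hquad : (1 + ‖x‖ ^ 2) ^ (α - 1 - 1) * |x i * x j| ≤ 1 := by
    calc (1 + ‖x‖ ^ 2) ^ (α - 1 - 1) * |x i * x j|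
        ≤ (1 + ‖x‖ ^ 2) ^ (α - 1 - 1) * (1 + ‖x‖ ^ 2) := by gcongr
      _ = (1 + ‖x‖ ^ 2) ^ (α - 1) := by
        rw [Real.rpow_sub_one hp0.ne', div_mul_cancel₀ _ hp0.ne']
      _ ≤ 1 := hrpow
  have hcoef : |α * (α - 1)| ≤ 1 := by
    rw [abs_le]
    constructor <;> nlinarith
  have hfirst : |(1 + ‖x‖ ^ 2) ^ (α - 1) * (2 * α) * (EuclideanSpace.single i (1 : ℝ) j)| ≤ 2 := by
    rw [abs_mul, abs_mul, abs_of_nonneg (a := 2 * α) (by linarith),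
      abs_of_nonneg (a := (1 + ‖x‖ ^ 2) ^ (α - 1)) (by positivity)]
    calc (1 + ‖x‖ ^ 2) ^ (α - 1) * (2 * α) * |EuclideanSpace.single i (1 : ℝ) j|
        ≤ 1 * (2 * 1) * 1 := by gcongr
      _ = 2 := by norm_num
  have hsecond : |4 * (α * (α - 1)) * ((1 + ‖x‖ ^ 2) ^ (α - 1 - 1) * (x i * x j))| ≤ 4 := by
    rw [abs_mul, abs_mul, abs_mul ((1 + ‖x‖ ^ 2) ^ (α - 1 - 1)),
      abs_of_nonneg (a := (1 + ‖x‖ ^ 2) ^ (α - 1 - 1)) (by positivity)]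
    calc |(4 : ℝ)| * |α * (α - 1)| * ((1 + ‖x‖ ^ 2) ^ (α - 1 - 1) * |x i * x j|)
        ≤ |(4 : ℝ)| * 1 * 1 := by gcongr
      _ = 4 := by norm_num
  rw [fderiv_weight_single]
  exact (abs_add_le _ _).trans (by linarith)

end Weight

/-- Weighted integration-by-parts estimate: for `α ∈ [0,1]` there is `C > 0`
(depending only on `α` and `d`) such that for every Schwartz `u : ℝ^d → ℂ` and
all coordinate directions `i, j`,
`|Re ∫ (1 + ‖x‖²)^{α−1} 2α x_j conj(∂_{x_j} u) ∂²_{x_i} u dx|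
  ≤ C(‖∂_{x_i} u‖_{L²}² + ‖u‖_{L²}² + ‖∂_{x_j} u‖_{L²}²)`. -/
theorem weighted_int_by_parts_bound (d : ℕ) (hd : 1 ≤ d) (α : ℝ)
    (hα : α ∈ Set.Icc (0 : ℝ) 1) :
    ∃ C : ℝ, 0 < C ∧
      ∀ (u : SchwartzMap (EuclideanSpace ℝ (Fin d)) ℂ) (i j : Fin d),
        |(∫ x : EuclideanSpace ℝ (Fin d),
            (((1 + ‖x‖ ^ 2) ^ (α - 1) * (2 * α) * x j : ℝ) : ℂ) *
              ((starRingEnd ℂ) (fderiv ℝ (⇑u) x (EuclideanSpace.single j 1)) *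
                fderiv ℝ (fun y => fderiv ℝ (⇑u) y (EuclideanSpace.single i 1)) x
                  (EuclideanSpace.single i 1))).re| ≤
          C * ((∫ x : EuclideanSpace ℝ (Fin d),
                  ‖fderiv ℝ (⇑u) x (EuclideanSpace.single i 1)‖ ^ 2) +
              (∫ x : EuclideanSpace ℝ (Fin d), ‖u x‖ ^ 2) +
              (∫ x : EuclideanSpace ℝ (Fin d),
                  ‖fderiv ℝ (⇑u) x (EuclideanSpace.single j 1)‖ ^ 2)) := by
  refine ⟨6, by norm_num, fun u i j => ?_⟩
  have hu : 0 ≤ ∫ x, ‖u x‖ ^ 2 := integral_nonneg fun x => sq_nonneg _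
  have hi : 0 ≤ ∫ x, ‖fderiv ℝ u x (EuclideanSpace.single i 1)‖ ^ 2 :=
    integral_nonneg fun x => sq_nonneg _
  have hj : 0 ≤ ∫ x, ‖fderiv ℝ u x (EuclideanSpace.single j 1)‖ ^ 2 :=
    integral_nonneg fun x => sq_nonneg _
  by_cases hint : Integrable (fun x : EuclideanSpace ℝ (Fin d) =>
      (((1 + ‖x‖ ^ 2) ^ (α - 1) * (2 * α) * x j : ℝ) : ℂ) *
        ((starRingEnd ℂ) (fderiv ℝ (⇑u) x (EuclideanSpace.single j 1)) *
          fderiv ℝ (fun y => fderiv ℝ (⇑u) y (EuclideanSpace.single i 1)) x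
            (EuclideanSpace.single i 1)))
  · have key := SchwartzMap.abs_integral_mul_inner_lineDerivOp_le (μ := volume)
      (hasTemperateGrowth_weight α j) (abs_fderiv_weight_single_le hα i j)
      (abs_fderiv_weight_single_le hα j j) u
    have hre := integral_re hint
    simp only [RCLike.re_to_complex, Complex.re_ofReal_mul] at hre
    rw [← hre]
    simp only [Complex.inner, SchwartzMap.lineDerivOp_apply_eq_fderiv] at key
    simp_rw [mul_comm ((starRingEnd ℂ) _)]
    refine key.trans ?_
    linarith
  · rw [integral_undef hint, Complex.zero_re, abs_zero]
    positivity
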